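/- Let r be a run of the FloodSet protocol and suppose W_i(r,m) = W_j(r,m) for all agents i and j nonfailed in run r at time m. Then W_i(r,m') = W_j(r,m') for all times m' with m ≤ m' ≤ t+1 and all agents i and j nonfailed in run r at time m'. -/

import Mathlib

namespace SBA

/-- The set of values `{0,1}`; `false` plays the role of `0`, `true` of `1`. -/
abbrev Values := Bool

/-- Actions of an agent in the SBA problem: decide a value, or do nothing. -/
inductive Action where
  | decide (v : Values)
  | noop
deriving DecidableEq

/-- An adversary: `F m i j = false` means agent `i`'s round-`m` message to `j`
is not delivered. -/
structure Adversary (n : ℕ) where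
  F : ℕ → Fin n → Fin n → Bool

/-- Validity of an adversary for the crash failure model `Crash_t`:
crashes are permanent, an undelivered message means the sender has crashed,
and at most `t` agents are faulty. -/
def Adversary.Valid {n : ℕ} (A : Adversary n) (t : ℕ) : Prop :=
  (∀ m i, A.F m i i = false → ∀ m', m < m' → ∀ k, A.F m' i k = false) ∧
  (∀ m i j, A.F m i j = false → A.F m i i = false) ∧
  {i : Fin n | ∃ m j, A.F m i j = false}.ncard ≤ t

/-- An information exchange: local state types, message types, the special
`crashed` state, a (bijective) choice of initial state for each initial value,
the message selection function `μ` and the state update function `δ`. -/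
structure InfoExchange (n : ℕ) where
  L : Fin n → Type
  M : Fin n → Type
  crashSt : ∀ i, L i
  initSt : ∀ i, Values → L i
  initInj : ∀ i, Function.Injective (initSt i)
  μ : ∀ i, L i → Action → (Fin n → Option (M i))
  δ : ∀ i, L i → Adversary n → Action → ((j : Fin n) → Option (M j)) → L i

/-- A decision protocol for information exchange `E`: each agent maps its
local state to an action. -/
def DecProtocol {n : ℕ} (E : InfoExchange n) := ∀ i : Fin n, E.L i → Action

/-- A run: a (constant) environment state (the adversary) together with, for
each time, a local state for each agent. -/
structure Run {n : ℕ} (E : InfoExchange n) where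
  env : Adversary n
  st : ℕ → (i : Fin n) → E.L i

/-- The vector of messages received by agent `i` in round `k+1`. -/
def recvd {n : ℕ} (E : InfoExchange n) (P : DecProtocol E) (r : Run E) (k : ℕ)
    (i : Fin n) : (j : Fin n) → Option (E.M j) :=
  fun j => if r.env.F (k+1) j i = true
           then E.μ j (r.st k j) (P j (r.st k j)) i else none

/-- Agent `i` has not been crashed by the adversary up to (and including) round `m`. -/
def aliveAt {n : ℕ} (A : Adversary n) (m : ℕ) (i : Fin n) : Prop :=
  ∀ k ≤ m, A.F k i i = true

instance {n : ℕ} (A : Adversary n) (m : ℕ) (i : Fin n) : Decidable (aliveAt A m i) := by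
  unfold aliveAt; infer_instance

/-- `r` is a run generated by decision protocol `P` with information exchange `E`
in the crash failure context `Crash_t`. -/
def IsRun {n : ℕ} (E : InfoExchange n) (P : DecProtocol E) (t : ℕ) (r : Run E) : Prop :=
  r.env.Valid t ∧
  (∀ i, ∃ v, r.st 0 i = E.initSt i v) ∧
  ∀ k i, r.st (k+1) i =
    if aliveAt r.env (k+1) i
    then E.δ i (r.st k i) r.env (P i (r.st k i)) (recvd E P r k i)
    else E.crashSt i

/-- The interpreted system `I_{P,E,Crash_t}`: the set of runs of `(P,E)` in `Crash_t`. -/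
def Runs {n : ℕ} (E : InfoExchange n) (P : DecProtocol E) (t : ℕ) : Set (Run E) :=
  {r | IsRun E P t r}

/-- Agent `i` is nonfailed at the point `(r,m)`, i.e. `i ∈ N(r,m)`. -/
def Nonfailed {n : ℕ} (E : InfoExchange n) (r : Run E) (m : ℕ) (i : Fin n) : Prop :=
  r.st m i ≠ E.crashSt i

/-- (Semantic) formulas: predicates on points. -/
abbrev Form {n : ℕ} (E : InfoExchange n) := Run E → ℕ → Prop

/-- Knowledge: `K_i φ` holds at `(r,m)` iff `φ` holds at every point of the
system `R` that is indistinguishable to agent `i` from `(r,m)`. -/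
def Kn {n : ℕ} (E : InfoExchange n) (R : Set (Run E)) (i : Fin n) (φ : Form E) : Form E :=
  fun r m => ∀ r' ∈ R, ∀ m', r.st m i = r'.st m' i → φ r' m'

/-- `E_N φ`: every nonfailed agent knows `φ`. -/
def EvK {n : ℕ} (E : InfoExchange n) (R : Set (Run E)) (φ : Form E) : Form E :=
  fun r m => ∀ i, Nonfailed E r m i → Kn E R i φ r m

/-- Common knowledge among the nonfailed agents: `E_N^k φ` for all `k ≥ 1`. -/
def CK {n : ℕ} (E : InfoExchange n) (R : Set (Run E)) (φ : Form E) : Form E :=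
  fun r m => ∀ k : ℕ, (EvK E R)^[k+1] φ r m

/-- The atomic proposition `∃v`: some agent has initial value `v` in the run. -/
def ExistsVal {n : ℕ} (E : InfoExchange n) (v : Values) : Form E :=
  fun r _m => ∃ i, r.st 0 i = E.initSt i v

/-- Two runs (of possibly different information exchanges) correspond: same
adversary and the same initial values for all agents. -/
def Corresponds {n : ℕ} (E1 E2 : InfoExchange n) (r1 : Run E1) (r2 : Run E2) : Prop :=
  r1.env = r2.env ∧ ∀ i, ∃ v, r1.st 0 i = E1.initSt i v ∧ r2.st 0 i = E2.initSt i v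

/-- Agreement: nonfailed agents decide the same value. -/
def Agreement {n : ℕ} (E : InfoExchange n) (P : DecProtocol E) (t : ℕ) : Prop :=
  ∀ r ∈ Runs E P t, ∀ (m m' : ℕ) (i j : Fin n) (v v' : Values),
    Nonfailed E r m i → Nonfailed E r m' j →
    P i (r.st m i) = Action.decide v → P j (r.st m' j) = Action.decide v' → v = v'

/-- Validity: any value decided by a nonfailed agent is some agent's initial value. -/
def ValidityP {n : ℕ} (E : InfoExchange n) (P : DecProtocol E) (t : ℕ) : Prop :=
  ∀ r ∈ Runs E P t, ∀ (m : ℕ) (i : Fin n) (v : Values),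
    Nonfailed E r m i → P i (r.st m i) = Action.decide v →
    ∃ j, r.st 0 j = E.initSt j v

/-- Simultaneity: if a nonfailed agent decides in a round, every nonfailed agent
decides in that round. -/
def Simultaneity {n : ℕ} (E : InfoExchange n) (P : DecProtocol E) (t : ℕ) : Prop :=
  ∀ r ∈ Runs E P t, ∀ (m : ℕ) (i j : Fin n) (v : Values),
    Nonfailed E r m i → Nonfailed E r m j →
    P i (r.st m i) = Action.decide v → ∃ w, P j (r.st m j) = Action.decide w

/-- Termination: every agent eventually decides or fails. -/
def TerminationP {n : ℕ} (E : InfoExchange n) (P : DecProtocol E) (t : ℕ) : Prop :=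
  ∀ r ∈ Runs E P t, ∀ i : Fin n,
    (∃ m, ¬ Nonfailed E r m i) ∨ (∃ m v, P i (r.st m i) = Action.decide v)

/-- `(P,E)` is an SBA protocol in the crash failure context `Crash_t`. -/
def IsSBA {n : ℕ} (E : InfoExchange n) (P : DecProtocol E) (t : ℕ) : Prop :=
  Agreement E P t ∧ ValidityP E P t ∧ Simultaneity E P t ∧ TerminationP E P t

/-- `E` does not transmit information about actions. -/
def NoActionInfo {n : ℕ} (E : InfoExchange n) : Prop :=
  ∀ (i : Fin n) (s : E.L i) (a₁ a₂ : Action),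
    E.μ i s a₁ = E.μ i s a₂ ∧ ∀ A v, E.δ i s A a₁ v = E.δ i s A a₂ v

/-- The trivial decision protocol (used to form `I_E` for an information exchange
that does not transmit information about actions). -/
def noopProt {n : ℕ} (E : InfoExchange n) : DecProtocol E := fun _ _ => Action.noop

/-- The interpreted system `I_E` of an information exchange that does not
transmit information about actions. -/
def Sys {n : ℕ} (E : InfoExchange n) (t : ℕ) : Set (Run E) :=
  Runs E (noopProt E) t

end SBA
namespace SBA

/-! ### Comparing information exchanges -/

/-- `E1` stores at least as much information as `E2`. -/
def StoresAtLeast {n : ℕ} (E1 E2 : InfoExchange n) (t : ℕ) : Prop :=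
  ∀ (r1 r3 : Run E1) (r2 r4 : Run E2),
    r1 ∈ Sys E1 t → r3 ∈ Sys E1 t → r2 ∈ Sys E2 t → r4 ∈ Sys E2 t →
    Corresponds E1 E2 r1 r2 → Corresponds E1 E2 r3 r4 →
    ∀ (m : ℕ) (i : Fin n), r1.st m i = r3.st m i → r2.st m i = r4.st m i

/-- `(r',m)` is `N`-reachable from `(r,m)` in `k` steps within the system `R`. -/
def NReach {n : ℕ} (E : InfoExchange n) (R : Set (Run E)) (m : ℕ) :
    ℕ → Run E → Run E → Prop
  | 0, r, r' => r = r'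
  | k+1, r, r' => ∃ r'', r'' ∈ R ∧ NReach E R m k r r'' ∧
      ∃ i : Fin n, Nonfailed E r'' m i ∧ Nonfailed E r' m i ∧ r''.st m i = r'.st m i

/-! ### Propositions about the environment -/

/-- A proposition about the environment: its truth value depends only on the
adversary, the agents' initial values, and the time. -/
def EnvProp (n : ℕ) := Adversary n → (Fin n → Values) → ℕ → Prop

/-- Interpretation of a proposition about the environment at a point of a run. -/
def envSat {n : ℕ} (E : InfoExchange n) (φ : EnvProp n) : Form E :=
  fun r m => ∃ f : Fin n → Values, (∀ i, r.st 0 i = E.initSt i (f i)) ∧ φ r.env f m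

/-! ### The knowledge-based program and optimality -/

/-- `P` is an implementation of the knowledge-based program `P^OPT` with respect
to `E` in `Crash_t`: at every point, for every nonfailed agent, `P` selects the
action chosen by the rule
`if K_i(C_N(∃0)) then decide 0 else if K_i(C_N(∃1)) then decide 1 else noop`. -/
def ImplementsOPT {n : ℕ} (E : InfoExchange n) (P : DecProtocol E) (t : ℕ) : Prop :=
  ∀ r ∈ Runs E P t, ∀ (m : ℕ) (i : Fin n), Nonfailed E r m i →
    (Kn E (Runs E P t) i (CK E (Runs E P t) (ExistsVal E false)) r m →
        P i (r.st m i) = Action.decide false) ∧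
    (¬ Kn E (Runs E P t) i (CK E (Runs E P t) (ExistsVal E false)) r m →
      Kn E (Runs E P t) i (CK E (Runs E P t) (ExistsVal E true)) r m →
        P i (r.st m i) = Action.decide true) ∧
    (¬ Kn E (Runs E P t) i (CK E (Runs E P t) (ExistsVal E false)) r m →
     ¬ Kn E (Runs E P t) i (CK E (Runs E P t) (ExistsVal E true)) r m →
        P i (r.st m i) = Action.noop)

/-- Self-Agreement: if an agent decides `v` and later decides `v'`, then `v = v'`. -/
def SelfAgreement {n : ℕ} (E : InfoExchange n) (P : DecProtocol E) (t : ℕ) : Prop :=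
  ∀ r ∈ Runs E P t, ∀ (i : Fin n) (m m' : ℕ) (v v' : Values), m ≤ m' →
    P i (r.st m i) = Action.decide v → P i (r.st m' i) = Action.decide v' → v = v'

/-- `P ≤_E P'`: whenever `P` decides, `P'` decides (in corresponding runs). -/
def ProtLE {n : ℕ} (E : InfoExchange n) (t : ℕ) (P P' : DecProtocol E) : Prop :=
  ∀ (r r' : Run E), r ∈ Runs E P t → r' ∈ Runs E P' t → Corresponds E E r r' →
    ∀ (m : ℕ) (i : Fin n) (v : Values),
      P i (r.st m i) = Action.decide v → ∃ w, P' i (r'.st m i) = Action.decide w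

/-- `P` is an optimum SBA protocol with respect to `E` in `Crash_t`. -/
def OptimumSBA {n : ℕ} (E : InfoExchange n) (P : DecProtocol E) (t : ℕ) : Prop :=
  IsSBA E P t ∧ ∀ P' : DecProtocol E, IsSBA E P' t → ProtLE E t P' P

/-! ### Receiving messages, clean rounds -/

/-- Agent `i` receives a message from agent `k` in round `m` (`m ≥ 1`) of run `r`. -/
def ReceivesFrom {n : ℕ} (E : InfoExchange n) (P : DecProtocol E) (r : Run E)
    (m : ℕ) (k i : Fin n) : Prop :=
  recvd E P r (m-1) i k ≠ none

/-- Round `m` of run `r` is clean: any message received by some nonfailed agent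
is received by every nonfailed agent. -/
def CleanRound {n : ℕ} (E : InfoExchange n) (P : DecProtocol E) (r : Run E)
    (m : ℕ) : Prop :=
  ∀ i j k : Fin n, Nonfailed E r m i → Nonfailed E r m j →
    ReceivesFrom E P r m k i → ReceivesFrom E P r m k j

/-! ### Distributed knowledge, number of failures, waste -/

/-- Distributed knowledge among the nonfailed agents. -/
def DK {n : ℕ} (E : InfoExchange n) (R : Set (Run E)) (φ : Form E) : Form E :=
  fun r m => ∀ r' ∈ R, (∀ i, Nonfailed E r m i → r.st m i = r'.st m i) → φ r' m

/-- The number of agents that have failed by time `k`. -/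
def numFailed {n : ℕ} (A : Adversary n) (k : ℕ) : ℕ :=
  (Finset.univ.filter (fun i : Fin n => ∃ m' ≤ k, A.F m' i i = false)).card

/-- `#KF(r,k)`: the largest `ℓ ≤ t` such that it is distributed knowledge among
the nonfailed agents at `(r,k)` that `ℓ` agents have failed. -/
noncomputable def numKF {n : ℕ} (E : InfoExchange n) (R : Set (Run E)) (t : ℕ)
    (r : Run E) (k : ℕ) : ℕ :=
  sSup {ℓ | ℓ ≤ t ∧ DK E R (fun r' m' => ℓ ≤ numFailed r'.env m') r k}

/-- The waste `W(r) = max_{k ≥ 0} (#KF(r,k) − k)`. -/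
noncomputable def Waste {n : ℕ} (E : InfoExchange n) (R : Set (Run E)) (t : ℕ)
    (r : Run E) : ℕ :=
  sSup {d | ∃ k, d = numKF E R t r k - k}

/-! ### minimum of a set of values -/

/-- The minimum of a (nonempty) set of values, where `false < true`. -/
def minW (W : Finset Bool) : Bool := if false ∈ W then false else true

end SBA
namespace SBA

/-- Local states of the FloodSet information exchange `E^flood`. -/
inductive FloodState where
  | crashed
  | live (W : Finset Bool) (m : ℕ) (v : Bool)
deriving DecidableEq

/-- The `W` component of a FloodSet local state. -/
def FloodState.Wof : FloodState → Finset Bool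
  | .crashed => ∅
  | .live W _ _ => W

/-- The FloodSet information exchange `E^flood`. -/
def floodE (n : ℕ) : InfoExchange n where
  L := fun _ => FloodState
  M := fun _ => Finset Bool
  crashSt := fun _ => .crashed
  initSt := fun _ v => .live {v} 0 v
  initInj := by
    intro i v v' h
    injection h with h1 h2 h3
  μ := fun _ s _ => match s with
    | .crashed => fun _ => none
    | .live W _ _ => fun _ => some W
  δ := fun _ s _ _ ms => match s with
    | .crashed => .crashed
    | .live W m v =>
        .live (W ∪ Finset.univ.biUnion (fun j => (ms j).getD ∅)) (m+1) v

end SBA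
namespace SBA

/-- Lynch's FloodSet decision rule: decide `min W_i` at time `t+1`. -/
def floodP (t : ℕ) : FloodState → Action
  | .crashed => .noop
  | .live W m _ => if m = t+1 then .decide (minW W) else .noop

/-- Lynch's FloodSet decision protocol. -/
def floodProt (n t : ℕ) : DecProtocol (floodE n) := fun _ s => floodP t s

end SBA
namespace SBA

/-- If all agents nonfailed at time `k` have seen the same set of values `w`, then so have
all agents nonfailed at time `k + 1`. -/
theorem flood_Wof_succ {n t : ℕ} {P : DecProtocol (floodE n)} {r : Run (floodE n)}
    (hr : r ∈ Runs (floodE n) P t) {k : ℕ} {w : Finset Bool}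
    (hw : ∀ j, Nonfailed (floodE n) r k j → FloodState.Wof (r.st k j) = w)
    {i : Fin n} (hi : Nonfailed (floodE n) r (k + 1) i) :
    FloodState.Wof (r.st (k + 1) i) = w := by
  have hstep := hr.2.2 k i
  unfold Nonfailed at hi
  split_ifs at hstep
  · rw [hstep] at hi ⊢
    have hwi := hw i
    unfold Nonfailed at hwi
    generalize r.st k i = s at hi hwi ⊢
    cases s with
    | crashed => exact absurd rfl hi
    | live W l v =>
      obtain rfl : W = w := hwi FloodState.noConfusion
      refine Finset.union_eq_left.2 (Finset.biUnion_subset.2 fun j _ => ?_)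
      have hwj := hw j
      unfold Nonfailed at hwj
      unfold recvd
      split_ifs
      · generalize r.st k j = s at hwj ⊢
        cases s with
        | crashed => exact Finset.empty_subset _
        | live W' l' v' => exact (hwj FloodState.noConfusion).le
      · exact Finset.empty_subset _
  · exact absurd hstep hi

/-- In a run of FloodSet, an agent that is nonfailed at time `k + 1` is nonfailed at time `k`. -/
theorem flood_nonfailed_of_succ {n t : ℕ} {P : DecProtocol (floodE n)} {r : Run (floodE n)}
    (hr : r ∈ Runs (floodE n) P t) {k : ℕ} {i : Fin n}
    (hi : Nonfailed (floodE n) r (k + 1) i) : Nonfailed (floodE n) r k i := by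
  intro hc
  have hstep := hr.2.2 k i
  rw [hc] at hstep
  split_ifs at hstep <;> exact hi hstep

/-- Lynch, Lemma 6.2: if `W_i(r,m) = W_j(r,m)` for all agents
nonfailed at time `m` of a run `r` of the FloodSet protocol, then
`W_i(r,m') = W_j(r,m')` for all `m ≤ m' ≤ t+1` and all agents nonfailed at `m'`. -/
theorem equal_W_persists
    {n t : ℕ} (ht : t < n) (r : Run (floodE n))
    (hr : r ∈ Runs (floodE n) (floodProt n t) t) (m : ℕ)
    (heq : ∀ i j : Fin n,
      Nonfailed (floodE n) r m i → Nonfailed (floodE n) r m j →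
      FloodState.Wof (r.st m i) = FloodState.Wof (r.st m j)) :
    ∀ m', m ≤ m' → m' ≤ t+1 →
      ∀ i j : Fin n,
        Nonfailed (floodE n) r m' i → Nonfailed (floodE n) r m' j →
        FloodState.Wof (r.st m' i) = FloodState.Wof (r.st m' j) := by
  intro m' hm
  induction m', hm using Nat.le_induction with
  | base => exact fun _ => heq
  | succ k _ ih =>
    intro hk i j hi hj
    have hw : ∀ l, Nonfailed (floodE n) r k l →
        FloodState.Wof (r.st k l) = FloodState.Wof (r.st k i) :=
      fun l hl => ih (Nat.le_of_succ_le hk) l i hl (flood_nonfailed_of_succ hr hi)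
    rw [flood_Wof_succ hr hw hi, flood_Wof_succ hr hw hj]

end SBA
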